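/- There exists a real constant $\delta^*$ with $0<\delta^*\leq 1/13$ such that there is no datum as in the hyperquotient setup satisfying all of: $\delta\leq\delta^*$; Rules I and II; and the cD–E form. -/

import Mathlib

open scoped BigOperators

namespace GapPaper

/-- Least non-negative residue of `n` modulo `r` (for `r > 0`). -/
def res (r n : ℤ) : ℤ := n % r

/-- The lattice `N = ℤ⁴ + ℤ·(1/r)(a,b,c,d)` inside `ℚ⁴`. -/
def latN (r a b c d : ℤ) : Set (Fin 4 → ℚ) :=
  {v | ∃ (j : ℤ) (m : Fin 4 → ℤ), ∀ i,
    v i = ((j * ![a, b, c, d] i : ℤ) : ℚ) / (r : ℚ) + (m i : ℚ)}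

/-- The positive orthant `σ`. -/
def orth : Set (Fin 4 → ℚ) := {v | ∀ i, 0 ≤ v i}

/-- The weight `w(v) = v₁ + v₂ + v₃ + v₄`. -/
def w (v : Fin 4 → ℚ) : ℚ := ∑ i, v i

/-- `v(f)`: the infimum over the monomials `m ∈ S` of their `v`-weights. -/
noncomputable def vf (S : Set (Fin 4 → ℕ)) (v : Fin 4 → ℚ) : ℝ :=
  sInf {x : ℝ | ∃ m ∈ S, x = ∑ i : Fin 4, (m i : ℝ) * ((v i : ℚ) : ℝ)}

/-- `v` is primitive in the lattice `N`. -/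
def IsPrim (r a b c d : ℤ) (v : Fin 4 → ℚ) : Prop :=
  ¬ ∃ (n : ℤ) (u : Fin 4 → ℚ), 2 ≤ n ∧ u ∈ latN r a b c d ∧ v = fun i => (n : ℚ) * u i

/-- The excluded set `{0, e₁, e₂, e₃, e₄}`. -/
def corners : Set (Fin 4 → ℚ) :=
  {v | v = 0 ∨ ∃ i₀ : Fin 4, v = fun i => if i = i₀ then 1 else 0}

/-- Every monomial of `S` has weight `e` for the `μ_r`-action with weights
`(a, b, c, d)`. -/
def WeightCond (r a b c d e : ℤ) (S : Set (Fin 4 → ℕ)) : Prop :=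
  ∀ m ∈ S, Int.ModEq r ((m 0 : ℤ) * a + (m 1 : ℤ) * b + (m 2 : ℤ) * c + (m 3 : ℤ) * d) e

/-- Rule I: `B` is a set with at most one element, whose element `β` (if any) is
primitive and satisfies `1 - δ < w(β) - β(f) < 1`, and every lattice vector in the
orthant other than `β`, `0`, `e₁`, ..., `e₄` satisfies `w(v) - v(f) > 1`. -/
def RuleI (r a b c d : ℤ) (δ : ℝ) (S : Set (Fin 4 → ℕ)) (B : Set (Fin 4 → ℚ)) : Prop :=
  B.Subsingleton ∧ B ⊆ latN r a b c d ∩ orth ∧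
    (∀ β ∈ B, IsPrim r a b c d β ∧
      1 - δ < ((w β : ℚ) : ℝ) - vf S β ∧ ((w β : ℚ) : ℝ) - vf S β < 1) ∧
    ∀ v ∈ latN r a b c d ∩ orth, v ∉ B → v ∉ corners → 1 < ((w v : ℚ) : ℝ) - vf S v

/-- Rule II. -/
def RuleII (r a b c d e : ℤ) : Prop :=
  (Int.gcd a r ∣ Int.gcd e r) ∧ (Int.gcd b r ∣ Int.gcd e r) ∧
  (Int.gcd c r ∣ Int.gcd e r) ∧ (Int.gcd d r ∣ Int.gcd e r) ∧
  Int.gcd a (Int.gcd b r) = 1 ∧ Int.gcd a (Int.gcd c r) = 1 ∧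
  Int.gcd a (Int.gcd d r) = 1 ∧ Int.gcd b (Int.gcd c r) = 1 ∧
  Int.gcd b (Int.gcd d r) = 1 ∧ Int.gcd c (Int.gcd d r) = 1 ∧
  Int.ModEq r (a + b + c + d - e) 1

/-- The vector `α_k = (1/r)(res(ak), res(bk), res(ck), res(dk))`. -/
def alphaK (r a b c d k : ℤ) : Fin 4 → ℚ :=
  fun i => ((res r (![a, b, c, d] i * k) : ℤ) : ℚ) / (r : ℚ)

/-- The unit cube `[0,1]⁴` minus its 16 vertices. -/
def cube : Set (Fin 4 → ℚ) :=
  {v | (∀ i, 0 ≤ v i ∧ v i ≤ 1) ∧ ¬ ∀ i, v i = 0 ∨ v i = 1}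

/-- The cA form: `f = xy + g(z,t)` with `g ∈ 𝔪²`. -/
def FormCA (S : Set (Fin 4 → ℕ)) : Prop :=
  ![1, 1, 0, 0] ∈ S ∧
    ∀ m ∈ S, m ≠ ![1, 1, 0, 0] → m 0 = 0 ∧ m 1 = 0 ∧ 2 ≤ m 2 + m 3

/-- The square form: `f = x² + (terms of order ≥ 2)`. -/
def FormSq (S : Set (Fin 4 → ℕ)) : Prop :=
  ![2, 0, 0, 0] ∈ S ∧ ∀ m ∈ S, 2 ≤ m 0 + m 1 + m 2 + m 3

/-- The odd form: `f = x² + y² + g(z,t)` with `g ∈ 𝔪³`. -/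
def FormOdd (S : Set (Fin 4 → ℕ)) : Prop :=
  ![2, 0, 0, 0] ∈ S ∧ ![0, 2, 0, 0] ∈ S ∧
    ∀ m ∈ S, m ≠ ![2, 0, 0, 0] → m ≠ ![0, 2, 0, 0] →
      m 0 = 0 ∧ m 1 = 0 ∧ 3 ≤ m 2 + m 3

/-- The cD–E form: `f = x² + g(y,z,t)` with `g ∈ 𝔪³`. -/
def FormCDE (S : Set (Fin 4 → ℕ)) : Prop :=
  ![2, 0, 0, 0] ∈ S ∧ ∀ m ∈ S, m ≠ ![2, 0, 0, 0] → m 0 = 0 ∧ 3 ≤ m 1 + m 2 + m 3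


lemma modEqSub (z t R : ℤ) (h0 : 0 ≤ z - t*R) (h1 : z - t*R < R) : z % R = z - t*R := by
  have : z % R = (z - t*R) % R := by simp [Int.sub_emod]
  rw [this, Int.emod_eq_of_lt h0 h1]

lemma zeroCase' (R X j1 : ℤ) (hR5 : 5 ≤ R) (hodd : R % 2 = 1) (hX0 : 0 ≤ X) (hX1 : X < R)
    (hy : j1 = 0 ∨ 50 ≤ R)
    (H : ∀ j, 1 ≤ j → 2*j < R → j ≠ j1 → ∃ i l n : ℕ, 3 ≤ i+l+n ∧
      (i:ℤ)*(R-j) + l*(2*j) + n*((X*j)%R) = R) : False := by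
  have P : ∀ j t, 1 ≤ j → 2*j < R → j ≠ j1 → 0 ≤ X*j - t*R → X*j - t*R < R →
      ((X*j - t*R) % 2 = 1 ∨ (1 ≤ X*j - t*R ∧ 2*(X*j - t*R) ≤ j)) := by
    intro j t h1 h2 h3 h4 h5
    obtain ⟨i, l, n, hd, he⟩ := H j h1 h2 h3
    rw [modEqSub _ t R h4 h5] at he
    generalize X*j - t*R = x at *
    rcases i with _ | _ | i
    · left
      simp only [Nat.cast_zero, zero_mul, zero_add] at he
      by_contra hx
      have hx0 : x % 2 = 0 := by omega
      obtain ⟨y, hy⟩ : ∃ y, x = 2*y := ⟨x/2, by omega⟩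
      subst hy
      have : R = 2*((l:ℤ)*j + n*y) := by linarith
      omega
    · right
      have hl : l = 0 := by
        rcases l with _ | l
        · rfl
        · exfalso
          push_cast at he
          have : 0 ≤ (l:ℤ)*j := by positivity
          have : 0 ≤ (n:ℤ)*x := by positivity
          linarith
      subst hl
      have hn : 2 ≤ n := by omega
      have hn' : (2:ℤ) ≤ n := by exact_mod_cast hn
      have e : (n:ℤ)*x = j := by push_cast at he; linarith
      constructor
      · by_contra hc
        have : x = 0 := by omega
        subst this; simp at e; omega
      · nlinarith
    · exfalso
      push_cast at he
      have : 0 ≤ (l:ℤ)*j := by positivity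
      have : 0 ≤ (n:ℤ)*x := by positivity
      have : 0 ≤ (i:ℤ)*(R-j) := mul_nonneg (by positivity) (by linarith)
      linarith
  have Y2 : X = R - 2 → False := by
    intro hX
    obtain ⟨j, hj1, hj2, hj3⟩ : ∃ j, 1 ≤ j ∧ j ≤ 2 ∧ j ≠ j1 ∧ 2 * j < R ∧ (50 ≤ R ∨ j = 1) :=
      if h : j1 = 1 then ⟨2, by omega, by omega, by omega, by omega, by omega⟩
      else ⟨1, by omega, by omega, by omega, by omega, by omega⟩
    obtain ⟨i, l, n, hd, he⟩ := H j hj1 (by omega) hj3.1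
    have hx : (X*j)%R = R - 2*j := by
      rw [modEqSub _ (j-1) R] <;> subst hX <;> ring_nf <;> omega
    rw [hx] at he
    have hbig : 50 ≤ R ∨ j = 1 := hj3.2.2
    have hR2 : R < 2*(R-2*j) := by omega
    have hp1 : 0 ≤ (l:ℤ)*j := by positivity
    have hp2 : 0 ≤ (n:ℤ)*(R-2*j) := mul_nonneg (by positivity) (by linarith)
    have hp3 : 0 ≤ (i:ℤ)*(R-j) := mul_nonneg (by positivity) (by linarith)
    rcases n with _ | _ | n
    · rcases i with _ | _ | i
      · have : R = 2*((l:ℤ)*j) := by push_cast at he; linarith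
        omega
      · have : (l:ℤ)*(2*j) = j := by push_cast at he; linarith
        rcases l with _ | l
        · simp at this; omega
        · push_cast at this
          have : 0 ≤ (l:ℤ)*j := by positivity
          linarith
      · push_cast at he
        have : 0 ≤ (i:ℤ)*(R-j) := mul_nonneg (by positivity) (by linarith)
        linarith
    · rcases i with _ | i
      · have : ((l:ℤ)-1)*(2*j) = 0 := by push_cast at he; linarith
        rcases mul_eq_zero.1 this with h | h <;> omega
      · push_cast at he
        have : 0 ≤ (i:ℤ)*(R-j) := mul_nonneg (by positivity) (by linarith)
        linarith
    · push_cast at he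
      have : 0 ≤ (n:ℤ)*(R-2*j) := mul_nonneg (by positivity) (by linarith)
      linarith
  -- the even `Y` case
  have YE : ∀ Y, X = R - Y → Y % 2 = 0 → 4 ≤ Y → 2*Y < R → (j1 ≤ 2 ∨ 3 ≤ j1) → False := by
    intro Y hXY hYe hY4 hYR _
    have hdm := Int.mul_ediv_add_emod R Y
    have hm0 := Int.emod_nonneg R (show Y ≠ 0 by omega)
    have hm1 := Int.emod_lt_of_pos R (show 0 < Y by omega)
    set s := R / Y with hs
    set ρ := R % Y with hρ
    have hρ0 : ρ ≠ 0 := by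
      intro h0
      obtain ⟨y, hy⟩ : ∃ y, Y = 2*y := ⟨Y/2, by omega⟩
      have : R = 2*(y*s) := by rw [h0, hy] at hdm; linarith
      omega
    have hs2 : 2 ≤ s := by
      by_contra hc
      have : s ≤ 1 := by omega
      nlinarith
    have hs4 : 4*s < R := by nlinarith [mul_nonneg (show 0 ≤ Y - 4 by omega) (show 0 ≤ s by omega), show 0 < ρ by omega]
    have hYs : (Y*s) % 2 = 0 := by rw [Int.mul_emod, hYe]; simp
    by_cases hj : s + 1 = j1
    · have hR50 : 50 ≤ R := by omega
      by_cases h3 : 3*Y ≤ R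
      · have e : X*(s+2) - (s)*R = R + ρ - 2*Y := by rw [hXY]; linarith
        have := P (s+2) s (by omega) (by omega) (by omega) (by omega) (by omega)
        rw [e] at this
        have e2 : ρ = R - Y*s := by linarith
        omega
      · have hs3 : s = 2 := by
          by_contra hc
          have : 3 ≤ s := by omega
          nlinarith
        have h4 := P 4 2 (by omega) (by omega) (by omega) (by omega) (by omega)
        have h7 := P 7 3 (by omega) (by omega) (by omega)
        omega
    · have e : X*(s+1) - (s-1)*R = R + ρ - Y := by rw [hXY]; linarith
      have := P (s+1) (s-1) (by omega) (by omega) (by omega) (by omega) (by omega)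
      rw [e] at this
      have e2 : ρ = R - Y*s := by linarith
      omega
  by_cases hX2 : X = R - 2
  · exact Y2 hX2
  by_cases h1 : j1 = 1
  · have h2a := P 2 0 (by omega) (by omega) (by omega)
    by_cases hXs : 2*X < R
    · omega
    by_cases hYe : (R - X) % 2 = 0
    · exact YE (R-X) (by ring) hYe (by omega) (by omega) (by omega)
    · have h3a := P 3 2 (by omega) (by omega) (by omega)
      have h4a := P 4 2 (by omega) (by omega) (by omega)
      have h5a := P 5 2 (by omega) (by omega) (by omega)
      have h3b := P 3 1 (by omega) (by omega) (by omega)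
      omega
  by_cases h2 : j1 = 2
  · have h1a := P 1 0 (by omega) (by omega) (by omega)
    by_cases hXs : 2*X < R
    · have h3a := P 3 0 (by omega) (by omega) (by omega)
      have h3b := P 3 1 (by omega) (by omega) (by omega)
      have h4a := P 4 0 (by omega) (by omega) (by omega)
      have h8 := P 8 2 (by omega) (by omega) (by omega)
      have h5 := P 5 1 (by omega) (by omega) (by omega)
      omega
    · exact YE (R-X) (by ring) (by omega) (by omega) (by omega) (by omega)
  · have h1a := P 1 0 (by omega) (by omega) (by omega)
    have h2a := P 2 0 (by omega) (by omega) (by omega)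
    have h2b := P 2 1 (by omega) (by omega) (by omega)
    exact YE (R-X) (by ring) (by omega) (by omega) (by omega) (by omega)

lemma zeroCase (R X y : ℤ) (hR5 : 5 ≤ R) (hodd : R % 2 = 1) (hy : R ∣ y ∨ 50 ≤ R)
    (H : ∀ j, 1 ≤ j → 2*j < R → ¬ R ∣ j - y → ¬ R ∣ j + y → ∃ i l n : ℕ, 3 ≤ i+l+n ∧
      (i:ℤ)*(R-j) + l*(2*j) + n*((X*j)%R) = R) : False := by
  have hy0 := Int.emod_nonneg y (show R ≠ 0 by omega)
  have hy1 := Int.emod_lt_of_pos y (show 0 < R by omega)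
  have hdm := Int.mul_ediv_add_emod y R
  have key : ∀ j, 1 ≤ j → 2*j < R → j ≠ y % R → j ≠ R - y % R → ¬ R ∣ j - y ∧ ¬ R ∣ j + y := by
    intro j h1 h2 h3 h4
    have e : y = R*(y/R) + y % R := hdm.symm
    constructor
    · intro h
      have h' : R ∣ j - y % R := by
        have := dvd_add h (dvd_mul_right R (y/R))
        rwa [show j - y + R*(y/R) = j - y % R by linarith] at this
      have := Int.eq_zero_of_abs_lt_dvd h' (by rw [abs_lt]; constructor <;> omega)
      omega
    · intro h
      have h' : R ∣ j + y % R - R := by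
        have := dvd_sub (dvd_sub h (dvd_mul_right R (y/R))) (dvd_refl R)
        rwa [show j + y - R*(y/R) - R = j + y % R - R by linarith] at this
      have := Int.eq_zero_of_abs_lt_dvd h' (by rw [abs_lt]; constructor <;> omega)
      omega
  refine zeroCase' R (X % R) (if 2*(y%R) < R then y % R else R - y % R) hR5 hodd
    (Int.emod_nonneg _ (by omega)) (Int.emod_lt_of_pos _ (by omega)) ?_ ?_
  · rcases hy with h | h
    · left; rw [Int.emod_eq_zero_of_dvd h]; simp; omega
    · right; exact h
  · intro j h1 h2 h3
    have := key j h1 h2 (by split_ifs at h3 <;> omega) (by split_ifs at h3 <;> omega)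
    obtain ⟨i, l, n, hd, he⟩ := H j h1 h2 this.1 this.2
    refine ⟨i, l, n, hd, ?_⟩
    have e : (X % R * j) % R = (X*j) % R := by simp [Int.mul_emod]
    rw [e]; exact he

structure Core (r a κ : ℤ) (u : Fin 3 → ℤ) : Prop where
  hr : 13 < r
  hκ : r ∣ κ ∨ 10000 < r
  h2 : ∀ k, ¬ r ∣ k - κ → ¬ r ∣ k + κ → r < 2*((a*k)%r) → ∃ n : Fin 3 → ℕ,
    3 ≤ n 0 + n 1 + n 2 ∧ r ∣ n 0 * u 0 + n 1 * u 1 + n 2 * u 2 - 2*a ∧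
    (n 0 : ℤ) * ((u 0 * k)%r) + n 1 * ((u 1 * k)%r) + n 2 * ((u 2 * k)%r) = 2*((a*k)%r) - r
  h3 : ∀ k, ¬ r ∣ k - κ → ¬ r ∣ k + κ → r ∣ a*k → (∀ v, ¬ r ∣ u v * k) → ∃ n : Fin 3 → ℕ,
    3 ≤ n 0 + n 1 + n 2 ∧
    (n 0 : ℤ) * ((u 0 * k)%r) + n 1 * ((u 1 * k)%r) + n 2 * ((u 2 * k)%r) = r
  h0 : ∃ n : Fin 3 → ℕ, n 0 + n 1 + n 2 = 3 ∧ r ∣ n 0 * u 0 + n 1 * u 1 + n 2 * u 2 - 2*a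
  hsum : r ∣ u 0 + u 1 + u 2 - 1 - a
  hcop : ∀ v, ∀ p : ℤ, p ∣ a → p ∣ u v → p ∣ r → IsUnit p
  hpair : ∀ v w, v ≠ w → ∀ p : ℤ, p ∣ u v → p ∣ u w → p ∣ r → IsUnit p
  hP : ∀ v k, r ∣ u v * k → r ∣ 2*k

lemma dvd_small {r z : ℤ} (h : r ∣ z) (h1 : -r < z) (h2 : z < r) : z = 0 :=
  Int.eq_zero_of_abs_lt_dvd h (abs_lt.2 ⟨h1, h2⟩)

lemma minP (n : Fin 3 → ℕ) (P : Fin 3 → ℤ) (T : ℤ) (hT : 0 ≤ T) (h3 : 3 ≤ n 0 + n 1 + n 2)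
    (h : (n 0 : ℤ) * P 0 + n 1 * P 1 + n 2 * P 2 = T) : ∃ v, 3 * P v ≤ T := by
  by_contra hc
  push Not at hc
  have h0 := mul_le_mul_of_nonneg_left (show T + 1 ≤ 3 * P 0 from hc 0) (Int.natCast_nonneg (n 0))
  have h1 := mul_le_mul_of_nonneg_left (show T + 1 ≤ 3 * P 1 from hc 1) (Int.natCast_nonneg (n 1))
  have h2 := mul_le_mul_of_nonneg_left (show T + 1 ≤ 3 * P 2 from hc 2) (Int.natCast_nonneg (n 2))
  have h4 : (3:ℤ) ≤ n 0 + n 1 + n 2 := by exact_mod_cast h3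
  nlinarith

section
variable {r a κ : ℤ} {u : Fin 3 → ℤ}

lemma Core.bad (C : Core r a κ u) {k : ℤ} (h : ¬ (¬ r ∣ k - κ ∧ ¬ r ∣ k + κ)) :
    r ∣ a*k - a*κ ∨ r ∣ a*k + a*κ := by
  by_cases h1 : r ∣ k - κ
  · left; rw [← mul_sub]; exact Dvd.dvd.mul_left h1 a
  · right
    have : r ∣ k + κ := by tauto
    rw [← mul_add]; exact Dvd.dvd.mul_left this a

lemma Core.full (C : Core r a κ u) (k A : ℤ) (h1 : ¬ r ∣ k - κ) (h2 : ¬ r ∣ k + κ)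
    (hA : r ∣ a*k - A) (hA1 : r < 2*A) (hA2 : A < r) : ∃ n : Fin 3 → ℕ,
    3 ≤ n 0 + n 1 + n 2 ∧ r ∣ n 0 * u 0 + n 1 * u 1 + n 2 * u 2 - 2*a ∧
    (n 0 : ℤ) * ((u 0 * k)%r) + n 1 * ((u 1 * k)%r) + n 2 * ((u 2 * k)%r) = 2*A - r ∧
    ∀ v, 1 ≤ (u v * k) % r := by
  have hr := C.hr
  have e : (a*k)%r = A := by
    obtain ⟨t, ht⟩ := hA
    have : a*k - t*r = A := by linarith
    rw [modEqSub (a*k) t r] <;> omega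
  obtain ⟨n, hn1, hn2, hn3⟩ := C.h2 k h1 h2 (by rw [e]; exact hA1)
  rw [e] at hn3
  refine ⟨n, hn1, hn2, hn3, fun v => ?_⟩
  by_contra hc
  have h0 := Int.emod_nonneg (u v * k) (show r ≠ 0 by omega)
  have : r ∣ u v * k := Int.dvd_of_emod_eq_zero (by omega)
  have h4 := C.hP v k this
  have h5 : r ∣ 2*A - r := by
    have := dvd_sub (dvd_sub (Dvd.dvd.mul_left h4 a) (Dvd.dvd.mul_left hA 2)) (dvd_refl r)
    rwa [show a*(2*k) - 2*(a*k - A) - r = 2*A - r by ring] at this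
  have := dvd_small h5 (by omega) (by omega)
  omega

lemma Core.small (C : Core r a κ u) (k A : ℤ) (h1 : ¬ r ∣ k - κ) (h2 : ¬ r ∣ k + κ)
    (hA : r ∣ a*k - A) (hA1 : r < 2*A) (hA2 : A < r) :
    ∃ v p, p = (u v * k) % r ∧ 1 ≤ p ∧ 3*p ≤ 2*A - r ∧ r ∣ u v * k - p := by
  obtain ⟨n, hn1, -, hn3, hn4⟩ := C.full k A h1 h2 hA hA1 hA2
  obtain ⟨v, hv⟩ := minP n (fun v => (u v * k) % r) _ (by omega) hn1 hn3
  exact ⟨v, _, rfl, hn4 v, hv, Int.dvd_self_sub_emod⟩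

lemma pr {r c i i' p p' x : ℤ} (h : r ∣ i*x - c*p) (h' : r ∣ i'*x - c*p')
    (hs1 : -r < c*(i*p' - i'*p)) (hs2 : c*(i*p' - i'*p) < r) : c*(i*p' - i'*p) = 0 := by
  apply dvd_small _ hs1 hs2
  have := dvd_sub (Dvd.dvd.mul_left h i') (Dvd.dvd.mul_left h' i)
  rwa [show i'*(i*x - c*p) - i*(i'*x - c*p') = c*(i*p' - i'*p) by ring] at this

lemma pigeon4 (v1 v2 v3 v4 : Fin 3) (h12 : v1 ≠ v2) (h13 : v1 ≠ v3) (h14 : v1 ≠ v4)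
    (h23 : v2 ≠ v3) (h24 : v2 ≠ v4) (h34 : v3 ≠ v4) : False := by
  simp only [ne_eq, Fin.ext_iff] at *; omega

lemma pigeon {r c : ℤ} (hr : 66 < r) (hc : c = 1 ∨ c = 2) (x : Fin 3 → ℤ)
    (H : ∀ i : ℤ, i = 3 ∨ i = 5 ∨ i = 7 ∨ i = 11 →
      ∃ v p, 1 ≤ p ∧ 3*p ≤ i ∧ r ∣ i * x v - c*p) : False := by
  obtain ⟨v1, p1, a1, b1, d1⟩ := H 3 (by tauto)
  obtain ⟨v2, p2, a2, b2, d2⟩ := H 5 (by tauto)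
  obtain ⟨v3, p3, a3, b3, d3⟩ := H 7 (by tauto)
  obtain ⟨v4, p4, a4, b4, d4⟩ := H 11 (by tauto)
  apply pigeon4 v1 v2 v3 v4 <;> rintro rfl
  · have := pr d1 d2; rcases hc with rfl | rfl <;> omega
  · have := pr d1 d3; rcases hc with rfl | rfl <;> omega
  · have := pr d1 d4; rcases hc with rfl | rfl <;> omega
  · have := pr d2 d3; rcases hc with rfl | rfl <;> omega
  · have := pr d2 d4; rcases hc with rfl | rfl <;> omega
  · have := pr d3 d4; rcases hc with rfl | rfl <;> omega

/-- `gcd(a,r) = 1`. -/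
lemma Core.unit (C : Core r a κ u) (s : ℤ) (hs : r ∣ a*s - 1) : False := by
  have hr := C.hr
  -- exceptional `κ` is nonzero as soon as some `k` with `a k` not `0` is bad
  have big : ∀ k A, r ∣ a*k - A → 0 < A → A < r → ¬ (¬ r ∣ k - κ ∧ ¬ r ∣ k + κ) → 10000 < r := by
    intro k A h1 h2 h3 h4
    rcases C.hκ with h | h
    · exfalso
      have h5 : r ∣ A := by
        have h6 : r ∣ a*κ := Dvd.dvd.mul_left h a
        rcases C.bad h4 with h7 | h7
        · have := dvd_sub (dvd_add h7 h6) h1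
          rwa [show a*k - a*κ + a*κ - (a*k - A) = A by ring] at this
        · have := dvd_sub (dvd_sub h7 h6) h1
          rwa [show a*k + a*κ - a*κ - (a*k - A) = A by ring] at this
      have := dvd_small h5 (by omega) (by omega)
      omega
    · exact h
  have two : ∀ k A k' A', r ∣ a*k - A → r ∣ a*k' - A' → r < 2*A → r < 2*A' → A < r → A' < r →
      A ≠ A' → ¬ (¬ r ∣ k - κ ∧ ¬ r ∣ k + κ) → (¬ r ∣ k' - κ ∧ ¬ r ∣ k' + κ) := by
    intro k A k' A' h1 h2 h3 h4 h5 h6 h7 h8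
    by_contra h9
    have key : r ∣ A - A' ∨ r ∣ A + A' - r := by
      rcases C.bad h8 with x | x <;> rcases C.bad h9 with y | y
      · left
        have := dvd_sub (dvd_sub x y) (dvd_sub h1 h2)
        rwa [show a*k - a*κ - (a*k' - a*κ) - (a*k - A - (a*k' - A')) = A - A' by ring] at this
      · right
        have := dvd_sub (dvd_sub (dvd_add x y) (dvd_add h1 h2)) (dvd_refl r)
        rwa [show a*k - a*κ + (a*k' + a*κ) - (a*k - A + (a*k' - A')) - r = A + A' - r by ring] at this
      · right
        have := dvd_sub (dvd_sub (dvd_add x y) (dvd_add h1 h2)) (dvd_refl r)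
        rwa [show a*k + a*κ + (a*k' - a*κ) - (a*k - A + (a*k' - A')) - r = A + A' - r by ring] at this
      · left
        have := dvd_sub (dvd_sub x y) (dvd_sub h1 h2)
        rwa [show a*k + a*κ - (a*k' + a*κ) - (a*k - A - (a*k' - A')) = A - A' by ring] at this
    rcases key with h | h
    · have := dvd_small h (by omega) (by omega); omega
    · have := dvd_small h (by omega) (by omega); omega
  obtain ⟨ρ, hρ | hρ⟩ := Int.even_or_odd' r
  · -- `r = 2ρ`
    have hk : ∀ A, r ∣ a*(s*A) - A := fun A => by
      have := Dvd.dvd.mul_right hs A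
      rwa [show (a*s-1)*A = a*(s*A) - A by ring] at this
    by_cases hg : ¬ r ∣ s*(ρ+1) - κ ∧ ¬ r ∣ s*(ρ+1) + κ
    · obtain ⟨v, p, -, h1, h2, -⟩ := C.small _ (ρ+1) hg.1 hg.2 (hk _) (by omega) (by omega)
      omega
    have hbig := big _ (ρ+1) (hk _) (by omega) (by omega) hg
    have aodd : ¬ (2:ℤ) ∣ a := by
      intro h
      have : (2:ℤ) ∣ 1 := by
        have h5 := dvd_sub (Dvd.dvd.mul_right h s) (dvd_trans (by omega : (2:ℤ) ∣ r) hs)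
        rwa [show a*s - (a*s-1) = 1 by ring] at h5
      omega
    have keven : ∀ k A, r ∣ a*k - A → 2 ∣ A → (2:ℤ) ∣ k := by
      intro k A h1 h2
      have : (2:ℤ) ∣ a*k := by
        have := dvd_add (dvd_trans (by omega : (2:ℤ) ∣ r) h1) h2
        rwa [show a*k - A + A = a*k by ring] at this
      exact (Int.prime_two.dvd_or_dvd this).resolve_left aodd
    have peven : ∀ k p x, (2:ℤ) ∣ k → r ∣ x*k - p → (2:ℤ) ∣ p := by
      intro k p x h1 h2
      have := dvd_sub (Dvd.dvd.mul_left h1 x) (dvd_trans (by omega : (2:ℤ) ∣ r) h2)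
      rwa [show x*k - (x*k - p) = p by ring] at this
    obtain ⟨τ, hτ | hτ⟩ := Int.even_or_odd' ρ
    · have hg2 := two _ _ (s*(ρ+2)) (ρ+2) (hk _) (hk _) (by omega) (by omega) (by omega) (by omega)
        (by omega) hg
      obtain ⟨v, p, -, h1, h2, h3⟩ := C.small _ (ρ+2) hg2.1 hg2.2 (hk _) (by omega) (by omega)
      have := peven _ _ _ (keven _ _ (hk (ρ+2)) (by omega)) h3
      omega
    · apply pigeon (r := r) (c := 2) (by omega) (by tauto) (fun v => u v * (s*(ρ+1)))
      intro i hi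
      have hki : r ∣ a*(i*(s*(ρ+1))) - (ρ+i) := by
        obtain ⟨t, ht⟩ : ∃ t, i = 2*t+1 := ⟨(i-1)/2, by omega⟩
        have h1 := dvd_add (hk (i*(ρ+1))) (dvd_mul_right r t)
        rwa [show a*(s*(i*(ρ+1))) - i*(ρ+1) + r*t = a*(i*(s*(ρ+1))) - (ρ+i) by
          rw [ht, hρ]; ring] at h1
      have hg2 := two _ _ (i*(s*(ρ+1))) (ρ+i) (hk _) hki (by omega) (by omega) (by omega) (by omega)
        (by omega) hg
      obtain ⟨v, p, -, h1, h2, h3⟩ := C.small _ (ρ+i) hg2.1 hg2.2 hki (by omega) (by omega)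
      obtain ⟨p', hp'⟩ := peven _ _ _ (keven _ _ hki (by omega)) h3
      refine ⟨v, p', by omega, by omega, ?_⟩
      rw [← hp']
      rwa [show u v * (i*(s*(ρ+1))) - p = i * (u v * (s*(ρ+1))) - p by ring] at h3
  · have hk : ∀ A, r ∣ a*(s*A) - A := fun A => by
      have := Dvd.dvd.mul_right hs A
      rwa [show (a*s-1)*A = a*(s*A) - A by ring] at this
    by_cases hg : ¬ r ∣ s*(ρ+1) - κ ∧ ¬ r ∣ s*(ρ+1) + κ
    · obtain ⟨v, p, -, h1, h2, -⟩ := C.small _ (ρ+1) hg.1 hg.2 (hk _) (by omega) (by omega)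
      omega
    have hbig := big _ (ρ+1) (hk _) (by omega) (by omega) hg
    apply pigeon (r := r) (c := 1) (by omega) (by tauto) (fun v => u v * (s*(ρ+1)))
    intro i hi
    have hki : r ∣ a*(i*(s*(ρ+1))) - (ρ+(i+1)/2) := by
      obtain ⟨t, ht⟩ : ∃ t, i = 2*t+1 := ⟨(i-1)/2, by omega⟩
      have h1 := dvd_add (hk (i*(ρ+1))) (dvd_mul_right r t)
      have e : (i+1)/2 = t+1 := by omega
      rwa [show a*(s*(i*(ρ+1))) - i*(ρ+1) + r*t = a*(i*(s*(ρ+1))) - (ρ+(i+1)/2) by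
        rw [e, ht, hρ]; ring] at h1
    have hg2 := two _ _ (i*(s*(ρ+1))) (ρ+(i+1)/2) (hk _) hki (by omega) (by omega) (by omega)
      (by omega) (by omega) hg
    obtain ⟨v, p, -, h1, h2, h3⟩ := C.small _ (ρ+(i+1)/2) hg2.1 hg2.2 hki (by omega) (by omega)
    refine ⟨v, p, by omega, by omega, ?_⟩
    rwa [show u v * (i*(s*(ρ+1))) - p = i * (u v * (s*(ρ+1))) - 1*p by ring] at h3

end

section
variable {r a κ : ℤ} {u : Fin 3 → ℤ}

lemma Core.qeven (C : Core r a κ u) (ha : (2:ℤ) ∣ a) (h2 : (2:ℤ) ∣ r) : False := by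
  have hu : ∀ v, ∃ t, u v = 2*t+1 := by
    intro v
    obtain ⟨t, ht | ht⟩ := Int.even_or_odd' (u v)
    · exfalso
      have := C.hcop v 2 ha ⟨t, ht⟩ h2
      rw [Int.isUnit_iff] at this
      omega
    · exact ⟨t, ht⟩
  obtain ⟨n, hn, hd⟩ := C.h0
  obtain ⟨t0, h0⟩ := hu 0
  obtain ⟨t1, h1⟩ := hu 1
  obtain ⟨t2, h2'⟩ := hu 2
  have hd2 := dvd_trans h2 hd
  rw [h0, h1, h2'] at hd2
  have hn' : (n 0 : ℤ) + n 1 + n 2 = 3 := by exact_mod_cast hn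
  have e : (n 0 : ℤ) * (2*t0+1) + n 1 * (2*t1+1) + n 2 * (2*t2+1) - 2*a
      = 2*(n 0 * t0 + n 1 * t1 + n 2 * t2 - a + 1) + 1 := by linear_combination hn'
  rw [e] at hd2
  omega

lemma Core.cop (C : Core r a κ u) {q : ℤ} (hqa : q ∣ a) (hqr : q ∣ r) (v : Fin 3) :
    IsCoprime q (u v) := by
  rw [Int.isCoprime_iff_gcd_eq_one]
  have := C.hcop v (Int.gcd q (u v)) (dvd_trans (Int.gcd_dvd_left ..) hqa) (Int.gcd_dvd_right ..)
    (dvd_trans (Int.gcd_dvd_left ..) hqr)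
  rw [Int.isUnit_iff] at this
  omega

lemma Core.same (C : Core r a κ u) {q R : ℤ} (hR : 0 < R) (hrq : r = q*R) (hqa : q ∣ a)
    (v : Fin 3) {x l1 l2 p1 p2 : ℤ} (h1 : r ∣ u v * (x + R*l1) - p1)
    (h2 : r ∣ u v * (x + R*l2) - p2) (hs1 : -R < p1 - p2) (hs2 : p1 - p2 < R) :
    q ∣ l1 - l2 := by
  have h3 := dvd_sub h1 h2
  have hRr : R ∣ r := ⟨q, by rw [hrq]; ring⟩
  have h4 : R ∣ p1 - p2 := by
    have := dvd_sub (dvd_mul_right R (u v * (l1 - l2))) (dvd_trans hRr h3)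
    rwa [show R * (u v * (l1-l2)) - (u v * (x + R*l1) - p1 - (u v * (x + R*l2) - p2)) = p1 - p2
      by ring] at this
  have h5 := dvd_small h4 hs1 hs2
  rw [show u v * (x + R*l1) - p1 - (u v * (x + R*l2) - p2) = (u v * (l1 - l2)) * R by
    linear_combination -h5, hrq] at h3
  have h6 := Int.dvd_of_mul_dvd_mul_right hR.ne' h3
  exact (C.cop hqa ⟨R, hrq⟩ v).dvd_of_dvd_mul_left h6

lemma Core.two (C : Core r a κ u) (k A k' A' : ℤ) (h1 : r ∣ a*k - A) (h2 : r ∣ a*k' - A')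
    (h3 : r < 2*A) (h4 : r < 2*A') (h5 : A < r) (h6 : A' < r)
    (h8 : ¬ (¬ r ∣ k - κ ∧ ¬ r ∣ k + κ)) (h9 : ¬ (¬ r ∣ k' - κ ∧ ¬ r ∣ k' + κ)) :
    r ∣ k - k' := by
  have hr := C.hr
  have key : r ∣ k - k' ∨ r ∣ k + k' := by
    have h8' : r ∣ k - κ ∨ r ∣ k + κ := by tauto
    have h9' : r ∣ k' - κ ∨ r ∣ k' + κ := by tauto
    rcases h8' with x | x <;> rcases h9' with y | y
    · left; simpa using dvd_sub x y
    · right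
      have := dvd_add x y
      rwa [show k - κ + (k' + κ) = k + k' by ring] at this
    · right
      have := dvd_add x y
      rwa [show k + κ + (k' - κ) = k + k' by ring] at this
    · left; simpa using dvd_sub x y
  rcases key with h | h
  · exact h
  · exfalso
    have := dvd_sub (dvd_sub (Dvd.dvd.mul_left h a) (dvd_add h1 h2)) (dvd_refl r)
    rw [show a*(k+k') - (a*k - A + (a*k' - A')) - r = A + A' - r by ring] at this
    have := dvd_small this (by omega) (by omega)
    omega

lemma Core.lift (C : Core r a κ u) {q R s : ℤ} (hrq : r = q*R) (hqa : q ∣ a) (hs : r ∣ a*s - q)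
    (hq5 : 5 ≤ q) (hq : q < 50) (hR : 200 < R) (hk : r ∣ a*κ) : False := by
  have hr := C.hr
  obtain ⟨h, c, hc, hh⟩ : ∃ h c : ℤ, (c = 1 ∨ c = 2) ∧ R = 2*h+2-c := by
    obtain ⟨h, hh | hh⟩ := Int.even_or_odd' R
    · exact ⟨h, 2, by tauto, by omega⟩
    · exact ⟨h, 1, by tauto, by omega⟩
  obtain ⟨a', ha'⟩ := hqa
  have hA : ∀ l, r ∣ a*(s*(h+1) + R*l) - q*(h+1) := by
    intro l
    have := dvd_add (Dvd.dvd.mul_right hs (h+1)) (dvd_mul_right r (a'*l))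
    rwa [show (a*s-q)*(h+1) + r*(a'*l) = a*(s*(h+1) + R*l) - q*(h+1) by rw [hrq, ha']; ring] at this
  have hA1 : 2*(q*(h+1)) - r = q*c := by rw [hrq, hh]; ring
  have hqc : q*c ≤ 2*q := by rcases hc with rfl | rfl <;> omega
  have hqc1 : 0 < q*c := by rcases hc with rfl | rfl <;> omega
  have hrb : 5*R ≤ r := by rw [hrq]; nlinarith
  have H : ∀ l, ∃ v p, 1 ≤ p ∧ 3*p ≤ 2*q ∧ r ∣ u v * (s*(h+1) + R*l) - p := by
    intro l
    have hg : ¬ r ∣ (s*(h+1) + R*l) - κ ∧ ¬ r ∣ (s*(h+1) + R*l) + κ := by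
      by_contra hb
      have h5 : r ∣ q*(h+1) - r := by
        rcases C.bad hb with h7 | h7
        · have := dvd_sub (dvd_sub (dvd_add h7 hk) (hA l)) (dvd_refl r)
          rwa [show a*(s*(h+1) + R*l) - a*κ + a*κ - (a*(s*(h+1) + R*l) - q*(h+1)) - r
            = q*(h+1) - r by ring] at this
        · have := dvd_sub (dvd_sub (dvd_sub h7 hk) (hA l)) (dvd_refl r)
          rwa [show a*(s*(h+1) + R*l) + a*κ - a*κ - (a*(s*(h+1) + R*l) - q*(h+1)) - r
            = q*(h+1) - r by ring] at this
      have := dvd_small h5 (by omega) (by omega)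
      omega
    obtain ⟨v, p, -, h1, h2, h3⟩ := C.small _ _ hg.1 hg.2 (hA l) (by omega) (by omega)
    exact ⟨v, p, h1, by omega, h3⟩
  obtain ⟨v1, p1, a1, b1, d1⟩ := H 0
  obtain ⟨v2, p2, a2, b2, d2⟩ := H 1
  obtain ⟨v3, p3, a3, b3, d3⟩ := H 2
  obtain ⟨v4, p4, a4, b4, d4⟩ := H 3
  have hqa : q ∣ a := ⟨a', ha'⟩
  have fin : ∀ z : ℤ, q ∣ z → -q < z → z < q → z = 0 := fun z => dvd_small
  apply pigeon4 v1 v2 v3 v4 <;> rintro rfl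
  · have := fin _ (C.same (by omega) hrq hqa _ d1 d2 (by omega) (by omega)) (by omega) (by omega); omega
  · have := fin _ (C.same (by omega) hrq hqa _ d1 d3 (by omega) (by omega)) (by omega) (by omega); omega
  · have := fin _ (C.same (by omega) hrq hqa _ d1 d4 (by omega) (by omega)) (by omega) (by omega); omega
  · have := fin _ (C.same (by omega) hrq hqa _ d2 d3 (by omega) (by omega)) (by omega) (by omega); omega
  · have := fin _ (C.same (by omega) hrq hqa _ d2 d4 (by omega) (by omega)) (by omega) (by omega); omega
  · have := fin _ (C.same (by omega) hrq hqa _ d3 d4 (by omega) (by omega)) (by omega) (by omega); omega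

lemma Core.q5aux (C : Core r a κ u) {q R s : ℤ} (hrq : r = q*R) (hqa : q ∣ a) (hs : r ∣ a*s - q)
    (hq5 : 5 ≤ q) (hodd : q % 2 = 1) (hR : 0 < R) (i j l : Fin 3)
    (hperm : ∀ F : Fin 3 → ℤ, F 0 + F 1 + F 2 = F i + F j + F l)
    (hij : q ∣ 2 * u i + u j) : False := by
  have hqr : q ∣ r := ⟨R, hrq⟩
  have hRr : R ∣ r := ⟨q, by rw [hrq]; ring⟩
  obtain ⟨α, β, hαβ⟩ := C.cop hqa hqr i
  obtain ⟨y, hy, hyκ⟩ : ∃ y : ℤ, (q ∣ y ∨ 50 ≤ q) ∧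
      (∀ t, ¬ q ∣ t - y → ¬ q ∣ t + y → ¬ r ∣ R*(-t*β) - κ ∧ ¬ r ∣ R*(-t*β) + κ) := by
    by_cases hκ : R ∣ κ
    · obtain ⟨κ', hκ'⟩ := hκ
      refine ⟨u i * κ', ?_, ?_⟩
      · by_cases h50 : 50 ≤ q
        · right; exact h50
        · left
          rcases C.hκ with h | h
          · rw [hκ', hrq, mul_comm q] at h
            exact Dvd.dvd.mul_left (Int.dvd_of_mul_dvd_mul_left hR.ne' h) _
          · exfalso
            apply C.lift hrq hqa hs hq5 (by omega) (by nlinarith)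
            rw [hκ', hrq, mul_comm R, ← mul_assoc]
            exact mul_dvd_mul_right (Dvd.dvd.mul_right hqa _) _
      · intro t h1 h2
        constructor
        · intro h
          apply h2
          rw [hκ', hrq, mul_comm q, ← mul_sub] at h
          have h3 := Int.dvd_of_mul_dvd_mul_left hR.ne' h
          have := dvd_sub (dvd_mul_right q (t*α)) (Dvd.dvd.mul_left h3 (u i))
          rwa [show q*(t*α) - u i * (-t*β - κ') = t + u i * κ' by
            linear_combination t * hαβ] at this
        · intro h
          apply h1
          rw [hκ', hrq, mul_comm q, ← mul_add] at h
          have h3 := Int.dvd_of_mul_dvd_mul_left hR.ne' h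
          have := dvd_sub (dvd_mul_right q (t*α)) (Dvd.dvd.mul_left h3 (u i))
          rwa [show q*(t*α) - u i * (-t*β + κ') = t - u i * κ' by
            linear_combination t * hαβ] at this
    · refine ⟨0, by simp, fun t _ _ => ⟨fun h => hκ ?_, fun h => hκ ?_⟩⟩
      · have := dvd_sub (dvd_mul_right R (-t*β)) (dvd_trans hRr h)
        simpa using this
      · have := dvd_sub (dvd_trans hRr h) (dvd_mul_right R (-t*β))
        simpa using this
  apply zeroCase q (-(u l)*β) y hq5 hodd hy
  intro t ht1 ht2 h1 h2
  obtain ⟨g1, g2⟩ := hyκ t h1 h2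
  have hqβ : IsCoprime q β := ⟨α, u i, by linarith⟩
  have hq2 : IsCoprime q 2 := by
    rw [Int.isCoprime_iff_gcd_eq_one]
    refine ⟨1, -(q/2), by omega⟩ |> fun (h : IsCoprime q 2) => Int.isCoprime_iff_gcd_eq_one.1 h
  obtain ⟨n, hn, hnP⟩ := C.h3 (R*(-t*β)) g1 g2
    (by
      rw [hrq, mul_comm R, ← mul_assoc]
      exact mul_dvd_mul_right (Dvd.dvd.mul_right hqa _) _)
    (by
      intro v hv
      have h3 := C.hP v _ hv
      rw [hrq, show 2*(R*(-t*β)) = (2*(β*(-t)))*R by ring] at h3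
      have h4 := Int.dvd_of_mul_dvd_mul_right hR.ne' h3
      have h5 := hqβ.dvd_of_dvd_mul_left (hq2.dvd_of_dvd_mul_left h4)
      have := dvd_small h5 (by omega) (by omega)
      omega)
  have em : ∀ v, (u v * (R*(-t*β))) % r = R * ((u v * (-t*β)) % q) := by
    intro v
    rw [hrq, mul_comm q, ← Int.mul_emod_mul_of_pos _ _ hR]
    congr 1; ring
  have hp := hperm (fun v => (n v : ℤ) * ((u v * (R*(-t*β))) % r))
  have hpn := hperm (fun v => (n v : ℤ))
  rw [hnP, em i, em j, em l] at hp
  have ei : (u i * (-t*β)) % q = q - t := by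
    rw [modEqSub _ (t*α - 1)]
    · linear_combination (-t) * hαβ
    · have : u i * (-t*β) - (t*α-1)*q = q - t := by linear_combination (-t) * hαβ
      omega
    · have : u i * (-t*β) - (t*α-1)*q = q - t := by linear_combination (-t) * hαβ
      omega
  obtain ⟨g, hg⟩ := hij
  have ej : (u j * (-t*β)) % q = 2*t := by
    have : u j * (-t*β) - (-t*β*g - 2*t*α)*q = 2*t := by
      linear_combination (2*t) * hαβ + (-t*β) * hg
    rw [modEqSub _ (-t*β*g - 2*t*α)] <;> omega
  rw [ei, ej] at hp
  refine ⟨n i, n j, n l, by omega, ?_⟩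
  apply mul_left_cancel₀ hR.ne'
  rw [show -(u l)*β*t = u l * (-t*β) by ring]
  linear_combination hrq - hp

lemma Core.q5 (C : Core r a κ u) {q R s : ℤ} (hrq : r = q*R) (hqa : q ∣ a) (hs : r ∣ a*s - q)
    (hq5 : 5 ≤ q) (hodd : q % 2 = 1) (hR : 0 < R) : False := by
  have hqr : q ∣ r := ⟨R, hrq⟩
  have key : ∀ i j l : Fin 3,
    (∀ F : Fin 3 → ℤ, F 0 + F 1 + F 2 = F i + F j + F l) → ¬ q ∣ 2 * u i + u j :=
    fun i j l h h' => C.q5aux hrq hqa hs hq5 hodd hR i j l h h'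
  obtain ⟨n, hn, hd⟩ := C.h0
  have hd2 : q ∣ n 0 * u 0 + n 1 * u 1 + n 2 * u 2 := by
    have := dvd_add (dvd_trans hqr hd) (Dvd.dvd.mul_left hqa 2)
    simpa using this
  have h3 : ∀ v, ¬ q ∣ 3 * u v := by
    intro v h
    have := (C.cop hqa hqr v).dvd_of_dvd_mul_right h
    have := dvd_small this (by omega) (by omega)
    omega
  have h1 : ¬ q ∣ u 0 + u 1 + u 2 := by
    intro h
    have := dvd_sub (dvd_sub h (dvd_trans hqr C.hsum)) hqa
    rw [show u 0 + u 1 + u 2 - (u 0 + u 1 + u 2 - 1 - a) - a = 1 by ring] at this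
    have := dvd_small this (by omega) (by omega)
    omega
  have k01 := key 0 1 2 (fun F => by ring)
  have k02 := key 0 2 1 (fun F => by ring)
  have k10 := key 1 0 2 (fun F => by ring)
  have k12 := key 1 2 0 (fun F => by ring)
  have k20 := key 2 0 1 (fun F => by ring)
  have k21 := key 2 1 0 (fun F => by ring)
  have e0 : n 0 ≤ 3 := by omega
  have e1 : n 1 ≤ 3 := by omega
  have e2 : n 2 = 3 - n 0 - n 1 := by omega
  rw [e2] at hd2
  have e3 : n 0 + n 1 ≤ 3 := by omega
  clear hd hn e2
  generalize n 0 = x at *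
  generalize n 1 = y at *
  interval_cases x <;> interval_cases y <;> first | omega | norm_num at hd2
  · exact h3 2 hd2
  · exact k21 (by rwa [add_comm] at hd2)
  · exact k12 hd2
  · exact h3 1 hd2
  · exact k20 (by rwa [add_comm] at hd2)
  · exact h1 hd2
  · exact k10 (by rwa [add_comm] at hd2)
  · exact k02 hd2
  · exact k01 hd2
  · exact h3 0 hd2

lemma Core.q3 (C : Core r a κ u) {R s c h : ℤ} (hrq : r = 3*R) (hqa : 3 ∣ a) (hs : r ∣ a*s - 3)
    (hc : c = 1 ∨ c = 2) (hh : R = 2*h+2-c) (hRc : 3*c < R) : False := by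
  have hr := C.hr
  obtain ⟨a', ha'⟩ := hqa
  have hqa : 3 ∣ a := ⟨a', ha'⟩
  have hA1 : ∀ l, r ∣ a*(s*(h+1) + R*l) - 3*(h+1) := by
    intro l
    have := dvd_add (Dvd.dvd.mul_right hs (h+1)) (dvd_mul_right r (a'*l))
    rwa [show (a*s-3)*(h+1) + r*(a'*l) = a*(s*(h+1) + R*l) - 3*(h+1) by rw [hrq, ha']; ring] at this
  have hA3 : ∀ l, r ∣ a*(3*(s*(h+1)) + R*l) - 3*(h+1+c) := by
    intro l
    have := dvd_add (Dvd.dvd.mul_right hs (3*(h+1))) (dvd_mul_right r (a'*l+1))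
    rwa [show (a*s-3)*(3*(h+1)) + r*(a'*l+1) = a*(3*(s*(h+1)) + R*l) - 3*(h+1+c) by
      rw [hrq, ha']; linear_combination 3*hh] at this
  have L1 : ∀ l, (¬ r ∣ (s*(h+1) + R*l) - κ ∧ ¬ r ∣ (s*(h+1) + R*l) + κ) →
      ∃ v p, 1 ≤ p ∧ p ≤ c ∧ r ∣ u v * (s*(h+1) + R*l) - p := by
    intro l hg
    obtain ⟨v, p, -, h1, h2, h3⟩ := C.small _ _ hg.1 hg.2 (hA1 l) (by omega) (by omega)
    exact ⟨v, p, h1, by omega, h3⟩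
  have L3 : ∀ l, (¬ r ∣ (3*(s*(h+1)) + R*l) - κ ∧ ¬ r ∣ (3*(s*(h+1)) + R*l) + κ) →
      ∃ v p, 1 ≤ p ∧ p ≤ 3*c ∧ r ∣ u v * (3*(s*(h+1)) + R*l) - p := by
    intro l hg
    obtain ⟨v, p, -, h1, h2, h3⟩ := C.small _ _ hg.1 hg.2 (hA3 l) (by omega) (by omega)
    exact ⟨v, p, h1, by omega, h3⟩
  have lf : ∀ x l1 l2, r ∣ (x + R*l1) - (x + R*l2) → 3 ∣ l1 - l2 := by
    intro x l1 l2 hd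
    rw [show (x + R*l1) - (x + R*l2) = (l1-l2)*R by ring, hrq] at hd
    exact Int.dvd_of_mul_dvd_mul_right (by omega) hd
  have S13 : ∀ v l0 p l p', 1 ≤ p → p ≤ c → r ∣ u v * (s*(h+1) + R*l0) - p →
      1 ≤ p' → p' ≤ 3*c → r ∣ u v * (3*(s*(h+1)) + R*l) - p' → 3 ∣ l := by
    intro v l0 p l p' h1 h2 h3 h4 h5 h6
    have h7 : r ∣ u v * (3*(s*(h+1)) + R*(3*l0)) - 3*p := by
      have := Dvd.dvd.mul_left h3 3
      rwa [show 3*(u v * (s*(h+1) + R*l0) - p) = u v * (3*(s*(h+1)) + R*(3*l0)) - 3*p by ring]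
        at this
    have := C.same (by omega) hrq hqa v h7 h6 (by omega) (by omega)
    omega
  by_cases hall : ∀ l, 0 ≤ l → l ≤ 2 → (¬ r ∣ (s*(h+1) + R*l) - κ ∧ ¬ r ∣ (s*(h+1) + R*l) + κ)
  · obtain ⟨v1, p1, a1, b1, d1⟩ := L1 0 (hall 0 (by omega) (by omega))
    obtain ⟨v2, p2, a2, b2, d2⟩ := L1 1 (hall 1 (by omega) (by omega))
    obtain ⟨v3, p3, a3, b3, d3⟩ := L1 2 (hall 2 (by omega) (by omega))
    obtain ⟨l, hl, hg⟩ : ∃ l, ¬ 3 ∣ l ∧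
        (¬ r ∣ (3*(s*(h+1)) + R*l) - κ ∧ ¬ r ∣ (3*(s*(h+1)) + R*l) + κ) := by
      by_contra hcon
      push Not at hcon
      have t1 := hcon 1 (by omega)
      have t2 := hcon 2 (by omega)
      have := lf _ _ _ (C.two _ _ _ _ (hA3 1) (hA3 2) (by omega) (by omega) (by omega) (by omega)
        (by tauto) (by tauto))
      omega
    obtain ⟨v4, p4, a4, b4, d4⟩ := L3 l hg
    apply pigeon4 v1 v2 v3 v4 <;> rintro rfl
    · have := C.same (by omega) hrq hqa _ d1 d2 (by omega) (by omega); omega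
    · have := C.same (by omega) hrq hqa _ d1 d3 (by omega) (by omega); omega
    · exact hl (S13 _ _ _ _ _ a1 b1 d1 a4 b4 d4)
    · have := C.same (by omega) hrq hqa _ d2 d3 (by omega) (by omega); omega
    · exact hl (S13 _ _ _ _ _ a2 b2 d2 a4 b4 d4)
    · exact hl (S13 _ _ _ _ _ a3 b3 d3 a4 b4 d4)
  · push Not at hall
    obtain ⟨l0, -, -, hb⟩ := hall
    have hb' : ¬ (¬ r ∣ (s*(h+1) + R*l0) - κ ∧ ¬ r ∣ (s*(h+1) + R*l0) + κ) := by tauto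
    have g1 : ∀ l, ¬ 3 ∣ l0 - l → (¬ r ∣ (s*(h+1) + R*l) - κ ∧ ¬ r ∣ (s*(h+1) + R*l) + κ) := by
      intro l hl
      by_contra hcon
      exact hl (lf _ _ _ (C.two _ _ _ _ (hA1 l0) (hA1 l) (by omega) (by omega) (by omega) (by omega)
        hb' hcon))
    have g3 : ∀ l, (¬ r ∣ (3*(s*(h+1)) + R*l) - κ ∧ ¬ r ∣ (3*(s*(h+1)) + R*l) + κ) := by
      intro l
      by_contra hcon
      have h1 := C.two _ _ _ _ (hA1 l0) (hA3 l) (by omega) (by omega) (by omega) (by omega)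
        hb' hcon
      have h2 := dvd_sub (Dvd.dvd.mul_left h1 a) (dvd_sub (hA1 l0) (hA3 l))
      rw [show a * (s*(h+1) + R*l0 - (3*(s*(h+1)) + R*l)) - (a*(s*(h+1) + R*l0) - 3*(h+1) -
        (a*(3*(s*(h+1)) + R*l) - 3*(h+1+c))) = -3*c by ring] at h2
      have := dvd_small h2 (by omega) (by omega)
      omega
    obtain ⟨v1, p1, a1, b1, d1⟩ := L1 (l0+1) (g1 _ (by omega))
    obtain ⟨v2, p2, a2, b2, d2⟩ := L1 (l0+2) (g1 _ (by omega))
    obtain ⟨v3, p3, a3, b3, d3⟩ := L3 1 (g3 _)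
    obtain ⟨v4, p4, a4, b4, d4⟩ := L3 2 (g3 _)
    apply pigeon4 v1 v2 v3 v4 <;> rintro rfl
    · have := C.same (by omega) hrq hqa _ d1 d2 (by omega) (by omega); omega
    · have := S13 _ _ _ _ _ a1 b1 d1 a3 b3 d3; omega
    · have := S13 _ _ _ _ _ a1 b1 d1 a4 b4 d4; omega
    · have := S13 _ _ _ _ _ a2 b2 d2 a3 b3 d3; omega
    · have := S13 _ _ _ _ _ a2 b2 d2 a4 b4 d4; omega
    · have := C.same (by omega) hrq hqa _ d3 d4 (by omega) (by omega); omega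

lemma par3 (x y z : ℤ) (n0 n1 n2 : ℕ) (hx : 2 ∣ x) (hy : ¬ 2 ∣ y) (hz : ¬ 2 ∣ z)
    (hn : n0 + n1 + n2 = 3) (h : (2:ℤ) ∣ n0 * x + n1 * y + n2 * z) : 1 ≤ n0 := by
  obtain ⟨x', rfl⟩ := hx
  obtain ⟨y', rfl⟩ : ∃ y', y = 2*y'+1 := ⟨y/2, by omega⟩
  obtain ⟨z', rfl⟩ : ∃ z', z = 2*z'+1 := ⟨z/2, by omega⟩
  rw [show (n0:ℤ) * (2*x') + n1 * (2*y'+1) + n2 * (2*z'+1)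
    = 2*(n0*x' + n1*y' + n2*z') + (n1 + n2) by ring] at h
  omega

lemma Core.q18 (C : Core r a κ u) {s : ℤ} (hr18 : r = 18) (hqa : 3 ∣ a) (hs : r ∣ a*s - 3) :
    False := by
  have h2r : (2:ℤ) ∣ r := by omega
  have hodd : ¬ (2:ℤ) ∣ a := by
    intro h
    have := dvd_sub (Dvd.dvd.mul_right h s) (dvd_trans h2r hs)
    rw [show a*s - (a*s-3) = 3 by ring] at this
    omega
  have n2 : ¬ IsUnit (2:ℤ) := by rw [Int.isUnit_iff]; omega
  have hsum := dvd_trans h2r C.hsum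
  have p01 : ¬ (2 ∣ u 0 ∧ 2 ∣ u 1) := fun h => n2 (C.hpair 0 1 (by decide) 2 h.1 h.2 h2r)
  have p02 : ¬ (2 ∣ u 0 ∧ 2 ∣ u 2) := fun h => n2 (C.hpair 0 2 (by decide) 2 h.1 h.2 h2r)
  have p12 : ¬ (2 ∣ u 1 ∧ 2 ∣ u 2) := fun h => n2 (C.hpair 1 2 (by decide) 2 h.1 h.2 h2r)
  obtain ⟨d, hd⟩ : ∃ d : Fin 3, ∀ n : Fin 3 → ℕ, n 0 + n 1 + n 2 = 3 →
      (2:ℤ) ∣ n 0 * u 0 + n 1 * u 1 + n 2 * u 2 → 1 ≤ n d := by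
    have hcase : (2 ∣ u 0 ∧ ¬ 2 ∣ u 1 ∧ ¬ 2 ∣ u 2) ∨ (2 ∣ u 1 ∧ ¬ 2 ∣ u 0 ∧ ¬ 2 ∣ u 2) ∨
        (2 ∣ u 2 ∧ ¬ 2 ∣ u 0 ∧ ¬ 2 ∣ u 1) := by omega
    rcases hcase with ⟨h1, h2, h3⟩ | ⟨h1, h2, h3⟩ | ⟨h1, h2, h3⟩
    · exact ⟨0, fun n hn h => par3 _ _ _ _ _ _ h1 h2 h3 hn h⟩
    · exact ⟨1, fun n hn h => par3 _ _ _ (n 1) (n 0) (n 2) h1 h2 h3 (by omega)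
        (by rwa [add_comm ((n 0 : ℤ) * u 0)] at h)⟩
    · exact ⟨2, fun n hn h => par3 _ _ _ (n 2) (n 0) (n 1) h1 h2 h3 (by omega)
        (by rwa [add_comm, ← add_assoc] at h)⟩
  have key : ∀ l, r ∣ u d * (4*s + 6*l) - 2 := by
    intro l
    have hA : r ∣ a*(4*s + 6*l) - 12 := by
      obtain ⟨a', ha'⟩ := hqa
      have := dvd_add (Dvd.dvd.mul_left hs 4) (dvd_mul_right r (a'*l))
      rwa [show 4*(a*s-3) + r*(a'*l) = a*(4*s+6*l) - 12 by rw [hr18, ha']; ring] at this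
    have hκ : r ∣ κ := C.hκ.resolve_right (by omega)
    have hg : ¬ r ∣ (4*s+6*l) - κ ∧ ¬ r ∣ (4*s+6*l) + κ := by
      by_contra hb
      have hk : r ∣ a*κ := Dvd.dvd.mul_left hκ a
      have : r ∣ 12 := by
        rcases C.bad hb with h7 | h7
        · have := dvd_sub (dvd_add h7 hk) hA
          rwa [show a*(4*s+6*l) - a*κ + a*κ - (a*(4*s+6*l) - 12) = 12 by ring] at this
        · have := dvd_sub (dvd_sub h7 hk) hA
          rwa [show a*(4*s+6*l) + a*κ - a*κ - (a*(4*s+6*l) - 12) = 12 by ring] at this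
      have := dvd_small this (by omega) (by omega)
      omega
    obtain ⟨n, hn1, hn2, hn3, hn4⟩ := C.full _ 12 hg.1 hg.2 hA (by omega) (by omega)
    have hP : ∀ v, 2 ≤ (u v * (4*s+6*l)) % r := by
      intro v
      have h1 := hn4 v
      have h2 : (2:ℤ) ∣ (u v * (4*s+6*l)) % r := by
        have := dvd_sub (show (2:ℤ) ∣ u v * (4*s+6*l) from Dvd.dvd.mul_left (by omega) _)
          (dvd_trans h2r (Int.dvd_self_sub_emod (x := u v * (4*s+6*l)) (m := r)))
        simpa using this
      omega
    have hz : ∀ v, 0 ≤ (n v : ℤ) * ((u v * (4*s+6*l)) % r - 2) := fun v =>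
      mul_nonneg (by positivity) (by linarith [hP v])
    have hs3 : (n 0 : ℤ) * ((u 0 * (4*s+6*l)) % r - 2) + n 1 * ((u 1 * (4*s+6*l)) % r - 2)
      + n 2 * ((u 2 * (4*s+6*l)) % r - 2) + 2*(n 0 + n 1 + n 2) = 6 := by
      rw [hr18] at hn3 ⊢; linear_combination hn3
    have z0 := hz 0
    have z1 := hz 1
    have z2 := hz 2
    have hsum3 : n 0 + n 1 + n 2 = 3 := by omega
    have hzero : ∀ v, (n v : ℤ) * ((u v * (4*s+6*l)) % r - 2) = 0 := by
      intro v; fin_cases v <;> simp only [Fin.isValue, Fin.zero_eta, Fin.mk_one, Fin.reduceFinMk] <;> omega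
    have hnd := hd n hsum3 (by
      have := dvd_add (dvd_trans h2r hn2) (dvd_mul_right 2 a)
      simpa using this)
    have h5 := (mul_eq_zero.1 (hzero d)).resolve_left (by omega)
    have h6 := Int.dvd_self_sub_emod (x := u d * (4*s+6*l)) (m := r)
    rwa [show (u d * (4*s+6*l)) % r = 2 by omega] at h6
  have := C.same (q := 3) (R := 6) (by omega) (by omega) hqa d (key 0) (key 1) (by omega) (by omega)
  omega

lemma Core.false (C : Core r a κ u) : False := by
  have hr := C.hr
  obtain ⟨q, s, hq0, hqa, ⟨R, hrq⟩, hs⟩ : ∃ q s : ℤ, 0 < q ∧ q ∣ a ∧ q ∣ r ∧ r ∣ a*s - q := by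
    refine ⟨Int.gcd a r, Int.gcdA a r, ?_, Int.gcd_dvd_left .., Int.gcd_dvd_right .., ?_⟩
    · have : 0 < Int.gcd a r := Int.gcd_pos_of_ne_zero_right _ (by omega)
      exact_mod_cast this
    · rw [Int.gcd_eq_gcd_ab]
      exact ⟨-Int.gcdB a r, by ring⟩
  have hR : 0 < R := by
    by_contra h
    have : q*R ≤ 0 := mul_nonpos_of_nonneg_of_nonpos hq0.le (by omega)
    omega
  by_cases hev : (2:ℤ) ∣ q
  · exact C.qeven (dvd_trans hev hqa) (dvd_trans hev ⟨R, hrq⟩)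
  by_cases h1 : q = 1
  · subst h1; exact C.unit s hs
  by_cases h3 : q = 3
  · subst h3
    obtain ⟨h, hh | hh⟩ := Int.even_or_odd' R
    · by_cases h6 : R = 6
      · exact C.q18 (by omega) hqa hs
      · exact C.q3 (c := 2) (h := h) hrq hqa hs (by tauto) (by omega) (by omega)
    · exact C.q3 (c := 1) (h := h) hrq hqa hs (by tauto) (by omega) (by omega)
  exact C.q5 hrq hqa hs (by omega) (by omega) hR

end

lemma dvd_cg {r x y : ℤ} (h : r ∣ x) (e : y = x) : r ∣ y := e ▸ h

def wt (m : Fin 4 → ℕ) (V : Fin 4 → ℤ) : ℤ :=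
  (m 0 : ℤ) * V 0 + m 1 * V 1 + m 2 * V 2 + m 3 * V 3

def sc (r : ℤ) (V : Fin 4 → ℤ) : Fin 4 → ℚ := fun i => (V i : ℚ) / (r : ℚ)

lemma wt_nonneg (m : Fin 4 → ℕ) (V : Fin 4 → ℤ) (hV : ∀ i, 0 ≤ V i) : 0 ≤ wt m V := by
  have h0 := hV 0
  have h1 := hV 1
  have h2 := hV 2
  have h3 := hV 3
  unfold wt
  positivity

lemma att {r : ℤ} (hr : 0 < r) {S : Set (Fin 4 → ℕ)} (hS : S.Nonempty) (V : Fin 4 → ℤ)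
    (hV : ∀ i, 0 ≤ V i) : ∃ m ∈ S, (∀ m' ∈ S, wt m V ≤ wt m' V) ∧
      ((w (sc r V) : ℚ) : ℝ) - vf S (sc r V)
        = ((V 0 + V 1 + V 2 + V 3 - wt m V : ℤ) : ℝ) / (r : ℝ) := by
  have hr' : (0:ℝ) < r := by exact_mod_cast hr
  obtain ⟨m, hm, hmin⟩ := (measure (fun m : Fin 4 → ℕ => (wt m V).toNat)).wf.has_min S hS
  have hmin' : ∀ m' ∈ S, wt m V ≤ wt m' V := by
    intro m' hm'
    have h1 := hmin m' hm'
    have h2 : ¬ (wt m' V).toNat < (wt m V).toNat := h1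
    have h3 := wt_nonneg m' V hV
    omega
  have hval : ∀ m : Fin 4 → ℕ, ∑ i : Fin 4, (m i : ℝ) * ((sc r V i : ℚ) : ℝ)
      = ((wt m V : ℤ) : ℝ) / r := by
    intro m
    simp only [Fin.sum_univ_four, sc, wt]
    push_cast
    field_simp
  refine ⟨m, hm, hmin', ?_⟩
  have hvf : vf S (sc r V) = ((wt m V : ℤ) : ℝ) / r := by
    unfold vf
    apply IsLeast.csInf_eq
    constructor
    · exact ⟨m, hm, (hval m).symm⟩
    · rintro x ⟨m', hm', rfl⟩
      rw [hval m']
      have : ((wt m V : ℤ) : ℝ) ≤ (wt m' V : ℤ) := by exact_mod_cast hmin' m' hm'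
      gcongr
  rw [hvf]
  simp only [w, Fin.sum_univ_four, sc]
  push_cast
  field_simp

section
variable {r a b c d e : ℤ} {δ : ℝ} {S : Set (Fin 4 → ℕ)} {B : Set (Fin 4 → ℚ)}

lemma sc_mem (hr : 0 < r) (V : Fin 4 → ℤ) (k : ℤ) (hk : ∀ i, r ∣ V i - k * ![a,b,c,d] i)
    (hV : ∀ i, 0 ≤ V i) : sc r V ∈ latN r a b c d ∩ orth := by
  have hr' : (0:ℚ) < r := by exact_mod_cast hr
  constructor
  · choose m hm using hk
    refine ⟨k, m, fun i => ?_⟩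
    have : (V i : ℚ) = ((k * ![a,b,c,d] i : ℤ) : ℚ) + r * m i := by
      have : V i = k * ![a,b,c,d] i + r * m i := by linarith [hm i]
      rw [this]; push_cast; ring
    simp only [sc, this]
    field_simp
  · intro i
    have : (0:ℚ) ≤ V i := by exact_mod_cast hV i
    simp only [sc]
    positivity

lemma rule (hr : 0 < r) (hS : S.Nonempty) (hI : RuleI r a b c d δ S B) (V : Fin 4 → ℤ) (k : ℤ)
    (hk : ∀ i, r ∣ V i - k * ![a,b,c,d] i) (hV : ∀ i, 0 ≤ V i) (hB : sc r V ∉ B)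
    (hc : ∃ i, V i ≠ 0 ∧ V i ≠ r) :
    ∃ m ∈ S, (∀ m' ∈ S, wt m V ≤ wt m' V) ∧ r + wt m V < V 0 + V 1 + V 2 + V 3 := by
  have hr' : (0:ℝ) < r := by exact_mod_cast hr
  have hrq : (r:ℚ) ≠ 0 := by exact_mod_cast hr.ne'
  obtain ⟨m, hm, hmin, he⟩ := att hr hS V hV
  refine ⟨m, hm, hmin, ?_⟩
  have := hI.2.2.2 _ (sc_mem hr V k hk hV) hB (by
    obtain ⟨i, h0, h1⟩ := hc
    rintro (h | ⟨i0, h⟩)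
    · have := congrFun h i
      simp only [sc, Pi.zero_apply, div_eq_zero_iff, hrq, or_false] at this
      exact h0 (by exact_mod_cast this)
    · have := congrFun h i
      simp only [sc] at this
      split_ifs at this
      · rw [div_eq_one_iff_eq hrq] at this
        exact h1 (by exact_mod_cast this)
      · simp only [div_eq_zero_iff, hrq, or_false] at this
        exact h0 (by exact_mod_cast this))
  rw [he, lt_div_iff₀ hr', one_mul] at this
  have : r < V 0 + V 1 + V 2 + V 3 - wt m V := by exact_mod_cast this
  omega

lemma inB (hr : 0 < r) (hS : S.Nonempty) (hI : RuleI r a b c d δ S B) (V : Fin 4 → ℤ)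
    (hV : ∀ i, 0 ≤ V i) (hB : sc r V ∈ B) :
    ∃ m ∈ S, V 0 + V 1 + V 2 + V 3 - wt m V < r ∧
      (1 - δ) * r < ((V 0 + V 1 + V 2 + V 3 - wt m V : ℤ) : ℝ) := by
  have hr' : (0:ℝ) < r := by exact_mod_cast hr
  obtain ⟨m, hm, hmin, he⟩ := att hr hS V hV
  obtain ⟨-, h1, h2⟩ := hI.2.2.1 _ hB
  rw [he] at h1 h2
  rw [lt_div_iff₀ hr'] at h1
  rw [div_lt_one hr'] at h2
  exact ⟨m, hm, by exact_mod_cast h2, h1⟩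

lemma exκ (hr : 13 < r) (hδ : δ ≤ 1/10000) (hS : S.Nonempty)
    (hI : RuleI r a b c d δ S B) (hab : Int.gcd a (Int.gcd b r) = 1) :
    ∃ κ, (r ∣ κ ∨ 10000 < r) ∧ ∀ (V : Fin 4 → ℤ) (k : ℤ), (∀ i, r ∣ V i - k * ![a,b,c,d] i) →
      sc r V ∈ B → r ∣ k - κ := by
  have hr' : (0:ℝ) < r := by exact_mod_cast (by omega : 0 < r)
  have hrq : (r:ℚ) ≠ 0 := by exact_mod_cast (by omega : r ≠ 0)
  rcases B.eq_empty_or_nonempty with rfl | ⟨β, hβ⟩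
  · exact ⟨0, by simp, fun V k _ h => absurd h (by simp)⟩
  obtain ⟨⟨j, m, hm⟩, hpos⟩ := hI.2.1 hβ
  set W : Fin 4 → ℤ := fun i => j * ![a,b,c,d] i + r * m i with hW
  have hβW : β = sc r W := by
    funext i
    rw [hm i]
    simp only [sc, hW]
    push_cast
    field_simp
  have hWpos : ∀ i, 0 ≤ W i := by
    intro i
    have h1 := hpos i
    rw [hβW] at h1
    simp only [sc] at h1
    have hrq' : (0:ℚ) < r := by exact_mod_cast (by omega : 0 < r)
    rw [le_div_iff₀ hrq', zero_mul] at h1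
    exact_mod_cast h1
  refine ⟨j, Or.inr ?_, ?_⟩
  · rw [hβW] at hβ
    obtain ⟨m', -, h1, h2⟩ := inB (by omega) hS hI W hWpos hβ
    have h3 : ((W 0 + W 1 + W 2 + W 3 - wt m' W : ℤ) : ℝ) ≤ r - 1 := by
      exact_mod_cast (by omega : W 0 + W 1 + W 2 + W 3 - wt m' W ≤ r - 1)
    have h4 : (10000:ℝ) < r := by nlinarith
    exact_mod_cast h4
  · intro V k hk hVB
    have hVW := hI.1 hVB hβ
    rw [hβW] at hVW
    have heq : ∀ i, V i = W i := by
      intro i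
      have := congrFun hVW i
      simp only [sc] at this
      rw [div_left_inj' hrq] at this
      exact_mod_cast this
    have hdv : ∀ i, r ∣ (k - j) * ![a,b,c,d] i := by
      intro i
      have h1 := hk i
      rw [heq i] at h1
      have := dvd_sub (dvd_mul_right r (m i)) h1
      simp only [hW] at this
      rwa [show r * m i - (j * ![a,b,c,d] i + r * m i - k * ![a,b,c,d] i)
        = (k - j) * ![a,b,c,d] i by ring] at this
    have ha : r ∣ (k-j)*a := hdv 0
    have hb : r ∣ (k-j)*b := hdv 1
    have h1 : ((Int.gcd a (Int.gcd b r) : ℕ) : ℤ) = 1 := by rw [hab]; rfl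
    rw [Int.gcd_eq_gcd_ab] at h1
    have h2 := Int.gcd_eq_gcd_ab b r
    set g := ((Int.gcd b r : ℕ) : ℤ)
    set x := Int.gcdA a g
    set y := Int.gcdB a g
    have := dvd_add (Dvd.dvd.mul_right ha x) (Dvd.dvd.mul_right (dvd_add
      (Dvd.dvd.mul_right hb (Int.gcdA b r)) (dvd_mul_right r ((k-j)*Int.gcdB b r))) y)
    refine dvd_cg this ?_
    linear_combination (-(k-j)) * h1 + (k-j)*y*h2

lemma cop3 {x y r p : ℤ} (h : Int.gcd x (Int.gcd y r) = 1) (h1 : p ∣ x) (h2 : p ∣ y) (h3 : p ∣ r) :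
    IsUnit p := by
  have := Int.dvd_coe_gcd h1 (Int.dvd_coe_gcd h2 h3)
  rw [h] at this
  exact isUnit_of_dvd_one (by simpa using this)

lemma hP_aux {x a e r : ℤ} (hx : Int.gcd x r ∣ Int.gcd e r) (hax : Int.gcd a (Int.gcd x r) = 1)
    (he : r ∣ e - 2*a) (k : ℤ) (hk : r ∣ x * k) : r ∣ 2*k := by
  have h1 : ((Int.gcd x r : ℕ) : ℤ) ∣ 2*a := by
    have h2 : ((Int.gcd x r : ℕ) : ℤ) ∣ e :=
      dvd_trans (by exact_mod_cast hx) (Int.gcd_dvd_left e r)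
    have := dvd_sub h2 (dvd_trans (Int.gcd_dvd_right x r) he)
    simpa using this
  have h2 : IsCoprime ((Int.gcd x r : ℕ) : ℤ) a := by
    rw [isCoprime_comm, Int.isCoprime_iff_gcd_eq_one]; exact hax
  have h3 : ((Int.gcd x r : ℕ) : ℤ) ∣ 2 := h2.dvd_of_dvd_mul_right h1
  obtain ⟨t, ht⟩ := h3
  rw [ht, Int.gcd_eq_gcd_ab]
  have := dvd_add (Dvd.dvd.mul_right hk (Int.gcdA x r * t)) (dvd_mul_right r (Int.gcdB x r * t * k))
  refine dvd_cg this ?_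
  ring

lemma neg_emod_add (x k r : ℤ) (hr : 0 < r) :
    (x*(-k))%r + (x*k)%r = r ∨ ((x*k)%r = 0 ∧ (x*(-k))%r = 0) := by
  have h1 := Int.emod_nonneg (x*k) hr.ne'
  have h2 := Int.emod_lt_of_pos (x*k) hr
  have h3 := Int.emod_nonneg (x*(-k)) hr.ne'
  have h4 := Int.emod_lt_of_pos (x*(-k)) hr
  have h5 : r ∣ (x*(-k))%r + (x*k)%r - r := by
    have e1 := Int.dvd_self_sub_emod (x := x*k) (m := r)
    have e2 := Int.dvd_self_sub_emod (x := x*(-k)) (m := r)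
    have := dvd_sub (dvd_neg.2 (dvd_add e1 e2)) (dvd_refl r)
    rwa [show -(x*k - x*k%r + (x*(-k) - x*(-k)%r)) - r = (x*(-k))%r + (x*k)%r - r by ring] at this
  by_cases h : (x*(-k))%r + (x*k)%r = 0
  · right; omega
  · left
    have := dvd_small h5 (by omega) (by omega)
    omega

lemma toCore (hr : 13 < r) (hδ : δ ≤ 1/10000) (hW : WeightCond r a b c d e S)
    (hI : RuleI r a b c d δ S B) (hII : RuleII r a b c d e) (hF : FormCDE S) :
    ∃ κ, Core r a κ ![b, c, d] := by
  obtain ⟨hF1, hF2⟩ := hF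
  have hS : S.Nonempty := ⟨_, hF1⟩
  obtain ⟨g1, g2, g3, g4, c1, c2, c3, c4, c5, c6, hm⟩ := hII
  have hr0 : 0 < r := by omega
  obtain ⟨κ, hκ, hκB⟩ := exκ hr hδ hS hI c1
  have he : r ∣ e - 2*a := by
    have := (hW _ hF1).dvd
    simpa [mul_comm] using this
  have hwm : ∀ m ∈ S, r ∣ (m 0 : ℤ) * a + m 1 * b + m 2 * c + m 3 * d - 2*a := by
    intro m hmS
    have := dvd_sub he (hW m hmS).dvd
    refine dvd_cg this ?_
    ring
  have hwt : ∀ (V : Fin 4 → ℤ) (k : ℤ), (∀ i, r ∣ V i - k * ![a,b,c,d] i) →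
      ∀ m ∈ S, r ∣ wt m V - 2*(a*k) := by
    intro V k hk m hmS
    have e0 : r ∣ V 0 - k*a := hk 0
    have e1 : r ∣ V 1 - k*b := hk 1
    have e2 : r ∣ V 2 - k*c := hk 2
    have e3 : r ∣ V 3 - k*d := hk 3
    have := dvd_add (Dvd.dvd.mul_left (hwm m hmS) k) (dvd_add (dvd_add (dvd_add
      (Dvd.dvd.mul_left e0 (m 0)) (Dvd.dvd.mul_left e1 (m 1))) (Dvd.dvd.mul_left e2 (m 2)))
      (Dvd.dvd.mul_left e3 (m 3)))
    refine dvd_cg this ?_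
    unfold wt
    ring
  have hwx : ∀ V, wt ![2,0,0,0] V = 2 * V 0 := by
    intro V; simp [wt]
  -- the vector alpha_k
  obtain ⟨al, hal⟩ : ∃ al : ℤ → Fin 4 → ℤ,
    ∀ k, al k = ![(a*k)%r, (b*k)%r, (c*k)%r, (d*k)%r] := ⟨_, fun k => rfl⟩
  have al0 : ∀ k, al k 0 = (a*k)%r := fun k => by rw [hal]; rfl
  have al1 : ∀ k, al k 1 = (b*k)%r := fun k => by rw [hal]; rfl
  have al2 : ∀ k, al k 2 = (c*k)%r := fun k => by rw [hal]; rfl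
  have al3 : ∀ k, al k 3 = (d*k)%r := fun k => by rw [hal]; rfl
  have alk : ∀ k i, r ∣ al k i - k * ![a,b,c,d] i := by
    intro k i
    have : al k i = (![a,b,c,d] i * k) % r := by
      fin_cases i
      · exact al0 k
      · exact al1 k
      · exact al2 k
      · exact al3 k
    rw [this, mul_comm k, ← dvd_neg, neg_sub]
    exact Int.dvd_self_sub_emod
  have alpos : ∀ k i, 0 ≤ al k i := by
    intro k i
    fin_cases i
    · exact (al0 k).symm ▸ Int.emod_nonneg _ hr0.ne'
    · exact (al1 k).symm ▸ Int.emod_nonneg _ hr0.ne'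
    · exact (al2 k).symm ▸ Int.emod_nonneg _ hr0.ne'
    · exact (al3 k).symm ▸ Int.emod_nonneg _ hr0.ne'
  have good : ∀ k, ¬ r ∣ k - κ → sc r (al k) ∉ B := fun k h h' => h (hκB _ k (alk k) h')
  have goodn : ∀ k, ¬ r ∣ k + κ → sc r (al (-k)) ∉ B := fun k h h' => h (by
    have := hκB _ (-k) (alk (-k)) h'
    rw [← dvd_neg] at this
    refine dvd_cg this ?_
    ring)
  refine ⟨κ, ⟨hr, hκ, ?_, ?_, ?_, ?_, ?_, ?_, ?_⟩⟩
  · intro k k1 k2 hA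
    have hAlt := Int.emod_lt_of_pos (a*k) hr0
    have na := neg_emod_add a k r hr0
    have nb := neg_emod_add b k r hr0
    have nc := neg_emod_add c k r hr0
    have nd := neg_emod_add d k r hr0
    obtain ⟨m, hmS, hmin, hlt⟩ := rule hr0 hS hI (al k) k (alk k) (alpos k) (good k k1)
      ⟨0, by rw [al0]; omega, by rw [al0]; omega⟩
    obtain ⟨m', hmS', hmin', hlt'⟩ := rule hr0 hS hI (al (-k)) (-k) (alk (-k)) (alpos (-k))
      (goodn k k2) ⟨0, by rw [al0]; omega, by rw [al0]; omega⟩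
    have b1 := hmin _ hF1
    have b2 := hmin' _ hF1
    have t1 := wt_nonneg m _ (alpos k)
    have t2 := wt_nonneg m' _ (alpos (-k))
    have q1 : r ∣ wt m (al k) - 2*((a*k)%r) + r := by
      have := dvd_add (dvd_add (hwt _ k (alk k) m hmS)
        (Dvd.dvd.mul_left (Int.dvd_self_sub_emod (x := a*k) (m := r)) 2)) (dvd_refl r)
      refine dvd_cg this ?_
      ring
    have q2 : r ∣ wt m' (al (-k)) - 2*((a*(-k))%r) := by
      have := dvd_add (hwt _ (-k) (alk (-k)) m' hmS')
        (Dvd.dvd.mul_left (Int.dvd_self_sub_emod (x := a*(-k)) (m := r)) 2)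
      refine dvd_cg this ?_
      ring
    rw [hwx] at b1 b2
    simp only [al0, al1, al2, al3] at hlt hlt' b1 b2
    have f2 := dvd_small q2 (by omega) (by omega)
    have f1 := dvd_small q1 (by omega) (by omega)
    have hne : m ≠ ![2,0,0,0] := by
      rintro rfl
      rw [hwx, al0] at f1
      omega
    obtain ⟨m0, m3⟩ := hF2 m hmS hne
    refine ⟨fun v => m v.succ, m3, ?_, ?_⟩
    · have := hwm m hmS
      rw [m0] at this
      simpa using this
    · have : wt m (al k) = (m 1 : ℤ) * ((b*k)%r) + m 2 * ((c*k)%r) + m 3 * ((d*k)%r) := by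
        simp [wt, m0, al1, al2, al3]
      have e4 : (m 1 : ℤ) * ((b*k)%r) + m 2 * ((c*k)%r) + m 3 * ((d*k)%r) = 2*((a*k)%r) - r := by
        omega
      exact e4
  · intro k k1 k2 hA hnz
    have na := neg_emod_add a k r hr0
    have nb := neg_emod_add b k r hr0
    have nc := neg_emod_add c k r hr0
    have nd := neg_emod_add d k r hr0
    have zb : (b*k)%r ≠ 0 := fun h => hnz 0 (Int.dvd_of_emod_eq_zero h)
    have zc : (c*k)%r ≠ 0 := fun h => hnz 1 (Int.dvd_of_emod_eq_zero h)
    have zd : (d*k)%r ≠ 0 := fun h => hnz 2 (Int.dvd_of_emod_eq_zero h)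
    have za : (a*k)%r = 0 := Int.emod_eq_zero_of_dvd hA
    have za' : (a*(-k))%r = 0 := by
      apply Int.emod_eq_zero_of_dvd; rw [mul_neg]; exact hA.neg_right
    have lb := Int.emod_lt_of_pos (b*k) hr0
    have lc := Int.emod_lt_of_pos (c*k) hr0
    have ld := Int.emod_lt_of_pos (d*k) hr0
    have pb := Int.emod_nonneg (b*k) hr0.ne'
    have pc := Int.emod_nonneg (c*k) hr0.ne'
    have pd := Int.emod_nonneg (d*k) hr0.ne'
    obtain ⟨m, hmS, hmin, hlt⟩ := rule hr0 hS hI (al k) k (alk k) (alpos k) (good k k1)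
      ⟨1, by rw [al1]; omega, by rw [al1]; omega⟩
    obtain ⟨m', hmS', hmin', hlt'⟩ := rule hr0 hS hI (al (-k)) (-k) (alk (-k)) (alpos (-k))
      (goodn k k2) ⟨1, by rw [al1]; omega, by rw [al1]; omega⟩
    have t1 := wt_nonneg m _ (alpos k)
    have t2 := wt_nonneg m' _ (alpos (-k))
    rw [al0, al1, al2, al3] at hlt hlt'
    have hk' : ∀ i, r ∣ ![r, (b*k)%r, (c*k)%r, (d*k)%r] i - k * ![a,b,c,d] i := by
      intro i
      fin_cases i
      · have := dvd_sub (dvd_refl r) hA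
        rwa [mul_comm] at this
      · exact al1 k ▸ alk k 1
      · exact al2 k ▸ alk k 2
      · exact al3 k ▸ alk k 3
    have hpos' : ∀ i, 0 ≤ ![r, (b*k)%r, (c*k)%r, (d*k)%r] i := by
      intro i
      fin_cases i
      · exact hr0.le
      · exact pb
      · exact pc
      · exact pd
    obtain ⟨m2, hmS2, hmin2, hlt2⟩ := rule hr0 hS hI ![r, (b*k)%r, (c*k)%r, (d*k)%r] k hk' hpos'
      (fun h => k1 (hκB _ k hk' h)) ⟨1, zb, lb.ne⟩
    have hlt2' : r + wt m2 ![r, (b*k)%r, (c*k)%r, (d*k)%r]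
      < r + (b*k)%r + (c*k)%r + (d*k)%r := hlt2
    have hne : m2 ≠ ![2,0,0,0] := by
      rintro rfl
      rw [hwx] at hlt2'
      have : r + 2 * r < r + (b*k)%r + (c*k)%r + (d*k)%r := hlt2'
      omega
    obtain ⟨m0, m3⟩ := hF2 m2 hmS2 hne
    have e4 : wt m2 ![r, (b*k)%r, (c*k)%r, (d*k)%r]
        = (m2 1 : ℤ) * ((b*k)%r) + m2 2 * ((c*k)%r) + m2 3 * ((d*k)%r) := by
      simp [wt, m0]
    have hd : r ∣ wt m2 ![r, (b*k)%r, (c*k)%r, (d*k)%r] - r := by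
      have := dvd_sub (dvd_add (hwt _ k hk' m2 hmS2) (Dvd.dvd.mul_left hA 2)) (dvd_refl r)
      simpa using this
    have hge : 0 < wt m2 ![r, (b*k)%r, (c*k)%r, (d*k)%r] := by
      rw [e4]
      have x1 := mul_le_mul_of_nonneg_left (show 1 ≤ (b*k)%r by omega) (Int.natCast_nonneg (m2 1))
      have x2 := mul_le_mul_of_nonneg_left (show 1 ≤ (c*k)%r by omega) (Int.natCast_nonneg (m2 2))
      have x3 := mul_le_mul_of_nonneg_left (show 1 ≤ (d*k)%r by omega) (Int.natCast_nonneg (m2 3))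
      omega
    have hz := dvd_small hd (by omega) (by omega)
    refine ⟨fun v => m2 v.succ, m3, ?_⟩
    have e5 : (m2 1 : ℤ) * ((b*k)%r) + m2 2 * ((c*k)%r) + m2 3 * ((d*k)%r) = r := by omega
    exact e5
  · have hk' : ∀ i, r ∣ ![2*r, r, r, r] i - 0 * ![a,b,c,d] i := by
      intro i
      fin_cases i <;> simp
    have hpos' : ∀ i, 0 ≤ ![2*r, r, r, r] i := by
      intro i
      fin_cases i <;> simp <;> omega
    have hw4 : ∀ m : Fin 4 → ℕ, wt m ![2*r, r, r, r]
        = r * (2 * m 0 + m 1 + m 2 + m 3) := by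
      intro m; simp [wt]; ring
    have hnB : sc r ![2*r, r, r, r] ∉ B := by
      intro hB
      obtain ⟨m, -, h1, h2⟩ := inB hr0 hS hI _ hpos' hB
      rw [hw4] at h1 h2
      have h1' : 2*r + r + r + r - r * (2 * m 0 + m 1 + m 2 + m 3) < r := h1
      have h2' : (1-δ)*r < ((2*r + r + r + r - r * (2 * m 0 + m 1 + m 2 + m 3) : ℤ) : ℝ) := h2
      have hr' : (0:ℝ) < r := by exact_mod_cast hr0
      have h3 : (4:ℤ) < 2 * m 0 + m 1 + m 2 + m 3 := by nlinarith
      have h4 : 2*r + r + r + r - r * (2 * m 0 + m 1 + m 2 + m 3) ≤ 0 := by nlinarith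
      have h5 : ((2*r + r + r + r - r * (2 * m 0 + m 1 + m 2 + m 3) : ℤ) : ℝ) ≤ 0 := by
        exact_mod_cast h4
      have h6 : 0 < (1-δ)*r := mul_pos (by linarith) hr'
      linarith
    obtain ⟨m, hmS, -, hlt⟩ := rule hr0 hS hI ![2*r, r, r, r] 0 hk' hpos' hnB
      ⟨0, by simp; omega, by simp; omega⟩
    rw [hw4] at hlt
    have hlt' : r + r * (2 * m 0 + m 1 + m 2 + m 3) < 2*r + r + r + r := hlt
    have h3 : (2 * m 0 + m 1 + m 2 + m 3 : ℤ) < 4 := by nlinarith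
    have hne : m ≠ ![2,0,0,0] := by
      rintro rfl
      simp at h3
    obtain ⟨m0, m3⟩ := hF2 m hmS hne
    refine ⟨fun v => m v.succ, ?_, ?_⟩
    · have : m 1 + m 2 + m 3 = 3 := by omega
      exact this
    · have := hwm m hmS
      rw [m0] at this
      simpa using this
  · have h1 := hm.symm.dvd
    have := dvd_add h1 he
    have h2 : r ∣ b + c + d - 1 - a := by
      refine dvd_cg this ?_
      ring
    exact h2
  · intro v p h1 h2 h3
    fin_cases v
    · exact cop3 c1 h1 h2 h3
    · exact cop3 c2 h1 h2 h3
    · exact cop3 c3 h1 h2 h3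
  · intro v x hvx p h1 h2 h3
    fin_cases v <;> fin_cases x
    · exact absurd rfl hvx
    · exact cop3 c4 h1 h2 h3
    · exact cop3 c5 h1 h2 h3
    · exact cop3 c4 h2 h1 h3
    · exact absurd rfl hvx
    · exact cop3 c6 h1 h2 h3
    · exact cop3 c5 h2 h1 h3
    · exact cop3 c6 h2 h1 h3
    · exact absurd rfl hvx
  · intro v k hk
    fin_cases v
    · exact hP_aux g2 c1 he k hk
    · exact hP_aux g3 c2 he k hk
    · exact hP_aux g4 c3 he k hk

end

/-- Exclusion of the cD–E case: no datum in the hyperquotient setup satisfies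
Rules I and II and the cD–E form. -/
theorem statement17 :
    ∃ δstar : ℝ, 0 < δstar ∧ δstar ≤ 1 / 13 ∧
      ∀ (r : ℤ) (δ : ℝ) (a b c d e : ℤ) (S : Set (Fin 4 → ℕ)) (B : Set (Fin 4 → ℚ)),
        13 < r → 0 < δ → δ ≤ δstar →
        WeightCond r a b c d e S → RuleI r a b c d δ S B → RuleII r a b c d e →
        FormCDE S → False := by
  refine ⟨1/10000, by norm_num, by norm_num, ?_⟩
  intro r δ a b c d e S B hr _ hδ hW hI hII hF
  obtain ⟨κ, C⟩ := toCore hr hδ hW hI hII hF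
  exact C.false

end GapPaper
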